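/- arXiv:math/0404141 — 8 statements merged into one kernel-verified Lean document; each statement's English description precedes it below -/
import Mathlib

section
/- In the polynomial ring ℚ[z_1,…,z_n,w_1,…,w_n], for all natural numbers r_1,s_1,r_2,s_2 one has B(τ_{(r_1,s_1)}, τ_{(r_2,s_2)}) = (r_1·s_2 − r_2·s_1)·τ_{(r_1+r_2, s_1+s_2)}, where the integer coefficient r_1 s_2 − r_2 s_1 is viewed in ℚ. -/
open MvPolynomial

/-- The variable `z_j` in `ℚ[z_1,…,z_n,w_1,…,w_n]`. -/
noncomputable def zVar (n : ℕ) (j : Fin n) : MvPolynomial (Fin n ⊕ Fin n) ℚ :=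
  X (Sum.inl j)

/-- The variable `w_j` (playing the role of `conj z_j`). -/
noncomputable def wVar (n : ℕ) (j : Fin n) : MvPolynomial (Fin n ⊕ Fin n) ℚ :=
  X (Sum.inr j)

/-- The bracket `B(f,g) = Σ_j z_j w_j (∂f/∂z_j ∂g/∂w_j − ∂f/∂w_j ∂g/∂z_j)`. -/
noncomputable def bracket (n : ℕ) (f g : MvPolynomial (Fin n ⊕ Fin n) ℚ) :
    MvPolynomial (Fin n ⊕ Fin n) ℚ :=
  ∑ j : Fin n, zVar n j * wVar n j *
    (pderiv (Sum.inl j) f * pderiv (Sum.inr j) g -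
     pderiv (Sum.inr j) f * pderiv (Sum.inl j) g)

/-- The bisymmetric power sum `τ_{(r,s)} = Σ_{j=1}^n z_j^r w_j^s`. -/
noncomputable def tau (n : ℕ) (r s : ℕ) : MvPolynomial (Fin n ⊕ Fin n) ℚ :=
  ∑ j : Fin n, zVar n j ^ r * wVar n j ^ s

theorem zVar_mul_pderiv_inl_tau (n r s : ℕ) (j : Fin n) :
    zVar n j * pderiv (Sum.inl j) (tau n r s) = (r : MvPolynomial (Fin n ⊕ Fin n) ℚ) *
      (zVar n j ^ r * wVar n j ^ s) := by
  rw [tau, map_sum, Finset.sum_eq_single j]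
  · cases r <;> simp [zVar, wVar]
    ring
  · intro i _ hij
    simp [zVar, wVar, hij]
  · simp

theorem wVar_mul_pderiv_inr_tau (n r s : ℕ) (j : Fin n) :
    wVar n j * pderiv (Sum.inr j) (tau n r s) = (s : MvPolynomial (Fin n ⊕ Fin n) ℚ) *
      (zVar n j ^ r * wVar n j ^ s) := by
  rw [tau, map_sum, Finset.sum_eq_single j]
  · cases s <;> simp [zVar, wVar]
    ring
  · intro i _ hij
    simp [zVar, wVar, hij]
  · simp

/-- `B(τ_{(r₁,s₁)}, τ_{(r₂,s₂)}) = (r₁ s₂ − r₂ s₁) · τ_{(r₁+r₂, s₁+s₂)}`. -/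
theorem bracket_tau_tau (n : ℕ) (hn : 1 ≤ n) (r₁ s₁ r₂ s₂ : ℕ) :
    bracket n (tau n r₁ s₁) (tau n r₂ s₂) =
      C ((r₁ : ℚ) * (s₂ : ℚ) - (r₂ : ℚ) * (s₁ : ℚ)) * tau n (r₁ + r₂) (s₁ + s₂) := by
  rw [bracket, tau.eq_def n (r₁ + r₂), Finset.mul_sum]
  refine Finset.sum_congr rfl fun j _ => ?_
  simp only [map_sub, map_mul, map_natCast]
  linear_combination
    wVar n j * pderiv (Sum.inr j) (tau n r₂ s₂) * zVar_mul_pderiv_inl_tau n r₁ s₁ j +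
    r₁ * (zVar n j ^ r₁ * wVar n j ^ s₁) * wVar_mul_pderiv_inr_tau n r₂ s₂ j -
    zVar n j * pderiv (Sum.inl j) (tau n r₂ s₂) * wVar_mul_pderiv_inr_tau n r₁ s₁ j -
    s₁ * (zVar n j ^ r₁ * wVar n j ^ s₁) * zVar_mul_pderiv_inl_tau n r₂ s₂ j
end

section
/- In ℚ[z_1,…,z_n,w_1,…,w_n], the ring of bisymmetric functions (the subring of invariants under the diagonal S_n-action) equals the smallest ℚ-subalgebra that contains the 2n power sums τ_{(m,0)} = z_1^m+⋯+z_n^m and τ_{(0,m)} = w_1^m+⋯+w_n^m for 1 ≤ m ≤ n and is closed under the bracket B. -/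
open MvPolynomial

/-- The subring of invariants of the diagonal `S_n`-action on
`ℚ[z_1,…,z_n,w_1,…,w_n]` (the ring of bisymmetric functions), as the
subalgebra of polynomials fixed by every simultaneous permutation of the
`z`'s and the `w`'s. -/
noncomputable def bisymmetricFunctions (n : ℕ) :
    Subalgebra ℚ (MvPolynomial (Fin n ⊕ Fin n) ℚ) :=
  ⨅ π : Equiv.Perm (Fin n),
    AlgHom.equalizer
      (rename (Sum.map π π) : MvPolynomial (Fin n ⊕ Fin n) ℚ →ₐ[ℚ]
        MvPolynomial (Fin n ⊕ Fin n) ℚ)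
      (AlgHom.id ℚ (MvPolynomial (Fin n ⊕ Fin n) ℚ))

/-- The power sums of degree at most the number of variables generate all power sums, and all
elementary symmetric polynomials, over `ℚ`. -/
theorem psum_mem_and_esymm_mem {σ : Type*} [Fintype σ] (A : Subalgebra ℚ (MvPolynomial σ ℚ))
    (hA : ∀ m, 1 ≤ m → m ≤ Fintype.card σ → psum σ ℚ m ∈ A) (k : ℕ) :
    psum σ ℚ k ∈ A ∧ esymm σ ℚ k ∈ A := by
  induction k using Nat.strong_induction_on with
  | _ k ih =>
  have hneg (j : ℕ) : (-1 : MvPolynomial σ ℚ) ^ j ∈ A := pow_mem (neg_mem (one_mem A)) j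
  rcases Nat.eq_zero_or_pos k with rfl | hk
  · simp [psum_zero, esymm_zero, one_mem, natCast_mem]
  by_cases hle : k ≤ Fintype.card σ
  · have hp : ∀ j ≤ k, psum σ ℚ j ∈ A := fun j hj ↦ by
      rcases hj.lt_or_eq with hj | rfl
      · exact (ih j hj).1
      · exact hA j hk hle
    refine ⟨hp k le_rfl, ?_⟩
    have hmem : (k : MvPolynomial σ ℚ) * esymm σ ℚ k ∈ A := by
      rw [mul_esymm_eq_sum]
      refine mul_mem (hneg _) (sum_mem fun a ha ↦ ?_)
      rw [Finset.mem_filter, Finset.HasAntidiagonal.mem_antidiagonal] at ha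
      exact mul_mem (mul_mem (hneg _) (ih _ ha.2).2) (hp _ (by lia))
    have hsmul : esymm σ ℚ k = (k : ℚ)⁻¹ • ((k : MvPolynomial σ ℚ) * esymm σ ℚ k) := by
      have hk0 : (k : ℚ) ≠ 0 := by positivity
      rw [← nsmul_eq_mul, ← Nat.cast_smul_eq_nsmul ℚ, smul_smul, inv_mul_cancel₀ hk0, one_smul]
    rw [hsmul]
    exact A.smul_mem hmem _
  · have hes : esymm σ ℚ k = 0 := by
      rw [esymm, Finset.powersetCard_eq_empty.2 (by simpa using hle), Finset.sum_empty]
    refine ⟨?_, hes ▸ zero_mem A⟩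
    rw [psum_eq_mul_esymm_sub_sum σ ℚ k hk, hes, mul_zero, zero_sub]
    refine neg_mem (sum_mem fun a ha ↦ ?_)
    rw [Finset.mem_filter, Finset.HasAntidiagonal.mem_antidiagonal, Set.mem_Ioo] at ha
    exact mul_mem (mul_mem (hneg _) (ih _ ha.2.2).2) (ih _ (by lia)).1

/-- If `G` is a multiplicatively closed family of functions whose sums over `ι` lie in `A`, then
so do the sums over injections `Fin k ↪ ι` of products of members of `G`. -/
theorem sum_embedding_prod_mem {K R ι : Type*} [CommRing K] [CommRing R] [Algebra K R]
    [Fintype ι] [DecidableEq ι] (A : Subalgebra K R) (G : Subsemigroup (ι → R))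
    (hG : ∀ g ∈ G, ∑ i, g i ∈ A) (k : ℕ) (g : Fin k → ι → R) (hg : ∀ i, g i ∈ G) :
    ∑ e : Fin k ↪ ι, ∏ i, g i (e i) ∈ A := by
  induction k with
  | zero =>
    simp only [Finset.univ_eq_empty, Finset.prod_empty, Finset.sum_const, nsmul_eq_mul, mul_one]
    exact natCast_mem A _
  | succ k ih =>
    have hcompl (e : Fin k ↪ ι) : ∑ j : {j // j ∉ Set.range e}, g 0 j =
        ∑ j, g 0 j - ∑ i, g 0 (e i) := by
      have himage : ∑ j : {j // j ∈ Set.range e}, g 0 j = ∑ i, g 0 (e i) :=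
        ((Equiv.ofInjective e e.injective).sum_comp fun j ↦ g 0 j).symm
      rw [eq_sub_iff_add_eq', ← himage]
      convert Fintype.sum_subtype_add_sum_subtype (· ∈ Set.range e) (g 0)
    have hmul (e : Fin k ↪ ι) (l : Fin k) : g 0 (e l) * ∏ i, g i.succ (e i) =
        ∏ i, Function.update (fun i ↦ g i.succ) l (g 0 * g l.succ) i (e i) := by
      rw [← Finset.mul_prod_erase _ _ (Finset.mem_univ l),
        ← Finset.mul_prod_erase _ _ (Finset.mem_univ l), Function.update_self, Pi.mul_apply,
        mul_assoc]
      congr 2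
      refine Finset.prod_congr rfl fun i hi ↦ ?_
      rw [Function.update_of_ne (Finset.ne_of_mem_erase hi)]
    have hsplit : ∑ e : Fin (k + 1) ↪ ι, ∏ i, g i (e i) =
        (∑ j, g 0 j) * ∑ e : Fin k ↪ ι, ∏ i, g i.succ (e i) -
          ∑ l, ∑ e : Fin k ↪ ι,
            ∏ i, Function.update (fun i ↦ g i.succ) l (g 0 * g l.succ) i (e i) := by
      rw [← (Equiv.embeddingFinSucc k ι).symm.sum_comp, Fintype.sum_sigma, Finset.sum_comm,
        Finset.mul_sum, ← Finset.sum_sub_distrib]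
      refine Finset.sum_congr rfl fun e _ ↦ ?_
      simp only [Fin.prod_univ_succ, Equiv.coe_embeddingFinSucc_symm, Fin.cons_zero,
        Fin.cons_succ]
      rw [← Finset.sum_mul, hcompl, sub_mul]
      simp only [← hmul, Finset.sum_mul]
    rw [hsplit]
    refine sub_mem (mul_mem (hG _ (hg 0)) (ih _ fun i ↦ hg _)) (sum_mem fun l _ ↦ ih _ fun i ↦ ?_)
    rcases eq_or_ne i l with rfl | hi
    · rw [Function.update_self]
      exact mul_mem (hg 0) (hg _)
    · rw [Function.update_of_ne hi]
      exact hg _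

theorem mem_bisymmetricFunctions {n : ℕ} {f : MvPolynomial (Fin n ⊕ Fin n) ℚ} :
    f ∈ bisymmetricFunctions n ↔ ∀ π : Equiv.Perm (Fin n), rename (Sum.map π π) f = f := by
  simp [bisymmetricFunctions, Algebra.mem_iInf, AlgHom.mem_equalizer]

theorem tau_mem_bisymmetricFunctions (n r s : ℕ) : tau n r s ∈ bisymmetricFunctions n := by
  refine mem_bisymmetricFunctions.2 fun π ↦ ?_
  simp only [tau, zVar, wVar, map_sum, map_mul, map_pow, rename_X, Sum.map_inl, Sum.map_inr]
  exact Equiv.sum_comp π fun j ↦ (X (Sum.inl j) ^ r * X (Sum.inr j) ^ s : MvPolynomial _ ℚ)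

theorem rename_bracket {n : ℕ} (π : Equiv.Perm (Fin n)) (f g : MvPolynomial (Fin n ⊕ Fin n) ℚ) :
    rename (Sum.map π π) (bracket n f g) =
      bracket n (rename (Sum.map π π) f) (rename (Sum.map π π) g) := by
  have hinj : Function.Injective (Sum.map π π) := π.injective.sumMap π.injective
  have hl (j : Fin n) (p : MvPolynomial (Fin n ⊕ Fin n) ℚ) :
      pderiv (Sum.inl (π j)) (rename (Sum.map π π) p) =
        rename (Sum.map π π) (pderiv (Sum.inl j) p) := pderiv_rename hinj (Sum.inl j) p
  have hr (j : Fin n) (p : MvPolynomial (Fin n ⊕ Fin n) ℚ) :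
      pderiv (Sum.inr (π j)) (rename (Sum.map π π) p) =
        rename (Sum.map π π) (pderiv (Sum.inr j) p) := pderiv_rename hinj (Sum.inr j) p
  rw [bracket, bracket, map_sum]
  refine Fintype.sum_equiv π _ _ fun j ↦ ?_
  simp only [hl, hr, zVar, wVar, map_mul, map_sub, rename_X, Sum.map_inl, Sum.map_inr]

theorem bracket_mem_bisymmetricFunctions {n : ℕ} {f g : MvPolynomial (Fin n ⊕ Fin n) ℚ}
    (hf : f ∈ bisymmetricFunctions n) (hg : g ∈ bisymmetricFunctions n) :
    bracket n f g ∈ bisymmetricFunctions n := by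
  rw [mem_bisymmetricFunctions] at *
  intro π
  rw [rename_bracket, hf, hg]

theorem bracket_tau_tau_zero (n r s : ℕ) :
    bracket n (tau n (r + 1) 0) (tau n 0 (s + 1)) =
      (((r : ℚ) + 1) * (s + 1)) • tau n (r + 1) (s + 1) := by
  simp only [bracket, tau, zVar, wVar, Finset.smul_sum]
  refine Finset.sum_congr rfl fun j _ ↦ ?_
  simp [Derivation.leibniz_pow, pderiv_X, Pi.single_apply, smul_eq_C_mul]
  ring

/-- The families `j ↦ z_j^a w_j^b`. -/
def bimonomials (n : ℕ) : Subsemigroup (Fin n → MvPolynomial (Fin n ⊕ Fin n) ℚ) where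
  carrier := {g | ∃ a b : ℕ, g = fun j ↦ zVar n j ^ a * wVar n j ^ b}
  mul_mem' := by
    rintro _ _ ⟨a, b, rfl⟩ ⟨c, d, rfl⟩
    refine ⟨a + c, b + d, funext fun j ↦ ?_⟩
    simp only [Pi.mul_apply, pow_add]
    ring

theorem sum_perm_rename_mem {n : ℕ} (A : Subalgebra ℚ (MvPolynomial (Fin n ⊕ Fin n) ℚ))
    (hA : ∀ r s, tau n r s ∈ A) (f : MvPolynomial (Fin n ⊕ Fin n) ℚ) :
    ∑ π : Equiv.Perm (Fin n), rename (Sum.map π π) f ∈ A := by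
  induction f using MvPolynomial.induction_on' with
  | add p q hp hq =>
    simp only [map_add, Finset.sum_add_distrib]
    exact add_mem hp hq
  | monomial d a =>
    have hprod (π : Equiv.Perm (Fin n)) : rename (Sum.map π π) (monomial d a) =
        a • ∏ i, (zVar n (π i) ^ d (Sum.inl i) * wVar n (π i) ^ d (Sum.inr i)) := by
      rw [monomial_eq, Finsupp.prod_fintype _ _ fun _ ↦ pow_zero _, Fintype.prod_sum_type,
        ← Finset.prod_mul_distrib]
      simp [zVar, wVar, smul_eq_C_mul]
    simp only [hprod, ← Finset.smul_sum]
    refine A.smul_mem ?_ a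
    rw [← (Equiv.embeddingEquivOfFinite (Fin n)).sum_comp]
    refine sum_embedding_prod_mem A (bimonomials n) ?_ n
      (fun i j ↦ zVar n j ^ d (Sum.inl i) * wVar n j ^ d (Sum.inr i)) fun i ↦ ⟨_, _, rfl⟩
    rintro _ ⟨r, s, rfl⟩
    exact hA r s

/-- The bisymmetric power sums generate the ring of bisymmetric functions. -/
theorem bisymmetricFunctions_le_of_tau_mem {n : ℕ}
    (A : Subalgebra ℚ (MvPolynomial (Fin n ⊕ Fin n) ℚ)) (hA : ∀ r s, tau n r s ∈ A) :
    bisymmetricFunctions n ≤ A := by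
  intro f hf
  rw [mem_bisymmetricFunctions] at hf
  have hsum := sum_perm_rename_mem A hA f
  simp only [hf, Finset.sum_const, Finset.card_univ, Fintype.card_perm, Fintype.card_fin] at hsum
  have hn0 : (n.factorial : ℚ) ≠ 0 := by positivity
  have := A.smul_mem hsum (n.factorial : ℚ)⁻¹
  rwa [← Nat.cast_smul_eq_nsmul ℚ, smul_smul, inv_mul_cancel₀ hn0, one_smul] at this

theorem tau_mem_of_bracket_closed {n : ℕ} (A : Subalgebra ℚ (MvPolynomial (Fin n ⊕ Fin n) ℚ))
    (hpow : ∀ m : ℕ, 1 ≤ m → m ≤ n → tau n m 0 ∈ A ∧ tau n 0 m ∈ A)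
    (hbr : ∀ f ∈ A, ∀ g ∈ A, bracket n f g ∈ A) (r s : ℕ) : tau n r s ∈ A := by
  have hz (m : ℕ) : rename Sum.inl (psum (Fin n) ℚ m) = tau n m 0 := by
    simp [psum, tau, zVar]
  have hw (m : ℕ) : rename Sum.inr (psum (Fin n) ℚ m) = tau n 0 m := by
    simp [psum, tau, wVar]
  have hz_mem (m : ℕ) : tau n m 0 ∈ A := by
    rw [← hz]
    refine (psum_mem_and_esymm_mem (A.comap (rename Sum.inl)) (fun m h1 hm ↦ ?_) m).1
    rw [Subalgebra.mem_comap, hz]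
    exact (hpow m h1 (by simpa using hm)).1
  have hw_mem (m : ℕ) : tau n 0 m ∈ A := by
    rw [← hw]
    refine (psum_mem_and_esymm_mem (A.comap (rename Sum.inr)) (fun m h1 hm ↦ ?_) m).1
    rw [Subalgebra.mem_comap, hw]
    exact (hpow m h1 (by simpa using hm)).2
  rcases r with _ | r
  · exact hw_mem s
  rcases s with _ | s
  · exact hz_mem _
  have hc : ((r : ℚ) + 1) * (s + 1) ≠ 0 := by positivity
  have := A.smul_mem (hbr _ (hz_mem (r + 1)) _ (hw_mem (s + 1))) (((r : ℚ) + 1) * (s + 1))⁻¹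
  rwa [bracket_tau_tau_zero, smul_smul, inv_mul_cancel₀ hc, one_smul] at this

/-- The ring of bisymmetric functions is the smallest `ℚ`-subalgebra of
`ℚ[z_1,…,z_n,w_1,…,w_n]` containing the `2n` power sums
`τ_{(m,0)}, τ_{(0,m)}` for `1 ≤ m ≤ n` and closed under the bracket `B`. -/
theorem bisymmetric_eq_poissonClosure_of_powerSums (n : ℕ) (hn : 1 ≤ n) :
    bisymmetricFunctions n =
      sInf {A : Subalgebra ℚ (MvPolynomial (Fin n ⊕ Fin n) ℚ) |
        (∀ m : ℕ, 1 ≤ m → m ≤ n → tau n m 0 ∈ A ∧ tau n 0 m ∈ A) ∧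
        (∀ f ∈ A, ∀ g ∈ A, bracket n f g ∈ A)} := by
  apply le_antisymm
  · exact le_sInf fun A hA ↦
      bisymmetricFunctions_le_of_tau_mem A (tau_mem_of_bracket_closed A hA.1 hA.2)
  · exact sInf_le ⟨fun m _ _ ↦ ⟨tau_mem_bisymmetricFunctions n m 0,
      tau_mem_bisymmetricFunctions n 0 m⟩, fun _ hf _ hg ↦ bracket_mem_bisymmetricFunctions hf hg⟩
end

section
/- In ℚ[z_1,…,z_n,w_1,…,w_n], the ring of bisymmetric functions (the subring of invariants under the diagonal S_n-action) equals the smallest ℚ-subalgebra that contains the elementary symmetric polynomials e_1(z),…,e_n(z) in the variables z_1,…,z_n and e_1(w),…,e_n(w) in the variables w_1,…,w_n and is closed under the bracket B. -/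
open MvPolynomial

/-- The `k`-th elementary symmetric polynomial in the variables `z_1,…,z_n`. -/
noncomputable def esymmZ (n : ℕ) (k : ℕ) : MvPolynomial (Fin n ⊕ Fin n) ℚ :=
  rename Sum.inl (esymm (Fin n) ℚ k)

/-- The `k`-th elementary symmetric polynomial in the variables `w_1,…,w_n`. -/
noncomputable def esymmW (n : ℕ) (k : ℕ) : MvPolynomial (Fin n ⊕ Fin n) ℚ :=
  rename Sum.inr (esymm (Fin n) ℚ k)

section EmbeddingSums

variable {ι k R : Type*} [Fintype ι] [CommRing k] [CommRing R] [Algebra k R]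

/-- The sum over embeddings of `Fin (m + 1)` is the product of a power sum with a sum over
embeddings of `Fin m`, corrected by the terms in which the two indices collide. -/
theorem sum_embedding_succ {m : ℕ} (g : Fin (m + 1) → ι → R) :
    ∑ e : Fin (m + 1) ↪ ι, ∏ j, g j (e j) =
      (∑ i, g 0 i) * ∑ e : Fin m ↪ ι, ∏ j, Fin.tail g j (e j) -
      ∑ l, ∑ e : Fin m ↪ ι,
        ∏ j, Function.update (Fin.tail g) l (g 0 * Fin.tail g l) j (e j) := by
  classical
  have hupdate (e : Fin m ↪ ι) (l : Fin m) :
      ∏ j, Function.update (Fin.tail g) l (g 0 * Fin.tail g l) j (e j) =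
        g 0 (e l) * ∏ j, Fin.tail g j (e j) := by
    rw [← Finset.mul_prod_erase _ _ (Finset.mem_univ l),
      ← Finset.mul_prod_erase _ (fun j => Fin.tail g j (e j)) (Finset.mem_univ l), ← mul_assoc]
    congr 1
    · simp
    · refine Finset.prod_congr rfl fun j hj => ?_
      rw [Function.update_of_ne (Finset.ne_of_mem_erase hj)]
  have hcompl (e : Fin m ↪ ι) :
      ∑ i : {i // i ∉ Set.range e}, g 0 i = ∑ i, g 0 i - ∑ l, g 0 (e l) := by
    rw [eq_sub_iff_add_eq', ← Fintype.sum_subtype_add_sum_subtype (· ∈ Set.range e) (g 0)]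
    congr 1
    convert (Equiv.ofInjective e e.injective).sum_comp fun i : Set.range e => g 0 i
    rfl
  have hfiber (e : Fin m ↪ ι) :
      ∑ i : {i // i ∉ Set.range e}, ∏ j, g j ((Equiv.embeddingFinSucc m ι).symm ⟨e, i⟩ j) =
        (∑ i, g 0 i) * ∏ j, Fin.tail g j (e j) -
          ∑ l, ∏ j, Function.update (Fin.tail g) l (g 0 * Fin.tail g l) j (e j) := by
    simp only [hupdate, ← Finset.sum_mul, ← sub_mul, ← hcompl]
    rw [Finset.sum_mul]
    refine Finset.sum_congr rfl fun i _ => ?_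
    simp [Fin.prod_univ_succ, Fin.tail]
  rw [Finset.sum_comm (s := (Finset.univ : Finset (Fin m))), Finset.mul_sum,
    ← Finset.sum_sub_distrib, ← (Equiv.embeddingFinSucc m ι).symm.sum_comp, Fintype.sum_sigma]
  exact Finset.sum_congr rfl fun e _ => hfiber e

/-- If `A` contains the sums over `ι` of all functions in `M`, then it contains the sums over all
embeddings `e` of `∏ j, g j (e j)` with every `g j` in `M`. -/
theorem sum_embedding_mem (A : Subalgebra k R) (M : Submonoid (ι → R))
    (hM : ∀ g ∈ M, ∑ i, g i ∈ A) {m : ℕ} (g : Fin m → ι → R) (hg : ∀ j, g j ∈ M) :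
    ∑ e : Fin m ↪ ι, ∏ j, g j (e j) ∈ A := by
  induction m with
  | zero => simp
  | succ m ih =>
    rw [sum_embedding_succ]
    refine sub_mem (mul_mem (hM _ (hg 0)) (ih _ fun j => hg j.succ))
      (sum_mem fun l _ => ih _ fun j => ?_)
    rcases eq_or_ne j l with rfl | hjl
    · simpa [Fin.tail] using mul_mem (hg 0) (hg j.succ)
    · simpa [hjl, Fin.tail] using hg j.succ

theorem sum_perm_mem (A : Subalgebra k R) {n : ℕ} (M : Submonoid (Fin n → R))
    (hM : ∀ g ∈ M, ∑ i, g i ∈ A) (g : Fin n → Fin n → R) (hg : ∀ j, g j ∈ M) :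
    ∑ π : Equiv.Perm (Fin n), ∏ j, g j (π j) ∈ A := by
  rw [← (Equiv.embeddingEquivOfFinite (Fin n)).sum_comp]
  exact sum_embedding_mem A M hM g hg

end EmbeddingSums

theorem esymmZ_mem_bisymmetricFunctions (n k : ℕ) : esymmZ n k ∈ bisymmetricFunctions n := by
  rw [mem_bisymmetricFunctions]
  intro π
  rw [esymmZ, rename_rename, show Sum.map π π ∘ Sum.inl = Sum.inl ∘ π from rfl, ← rename_rename, rename_esymm]

theorem esymmW_mem_bisymmetricFunctions (n k : ℕ) : esymmW n k ∈ bisymmetricFunctions n := by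
  rw [mem_bisymmetricFunctions]
  intro π
  rw [esymmW, rename_rename, show Sum.map π π ∘ Sum.inr = Sum.inr ∘ π from rfl, ← rename_rename, rename_esymm]

/-- A subalgebra containing the images of `e_1,…,e_n` under an algebra map contains the images of
all symmetric polynomials. -/
theorem map_mem_of_isSymmetric {k R : Type*} [CommRing k] [CommRing R] [Algebra k R]
    {n : ℕ} (φ : MvPolynomial (Fin n) k →ₐ[k] R) (A : Subalgebra k R)
    (h : ∀ i, 1 ≤ i → i ≤ n → φ (esymm (Fin n) k i) ∈ A)
    {p : MvPolynomial (Fin n) k} (hp : p.IsSymmetric) : φ p ∈ A := by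
  obtain ⟨q, hq⟩ := esymmAlgHom_surjective (σ := Fin n) (n := n) k (by simp) ⟨p, hp⟩
  have hpq : p = aeval (fun i : Fin n => esymm (Fin n) k (i + 1)) q := by
    rw [← esymmAlgHom_apply, hq]
  rw [hpq, ← AlgHom.comp_apply, comp_aeval]
  have (i : Fin n) := h (i + 1) (by omega) (by omega)
  have hlift : (aeval fun i : Fin n => φ (esymm (Fin n) k (i + 1))) q =
      A.val (aeval (fun i : Fin n => (⟨φ (esymm (Fin n) k (i + 1)), this i⟩ : A)) q) := by
    rw [← AlgHom.comp_apply, comp_aeval]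
    rfl
  rw [hlift]
  exact Subtype.property _

/-- The polarized power sum `Σ_j z_j^a w_j^b`. -/
noncomputable def polarizedPsum (n a b : ℕ) : MvPolynomial (Fin n ⊕ Fin n) ℚ :=
  ∑ j, zVar n j ^ a * wVar n j ^ b

theorem bracket_polarizedPsum (n a b : ℕ) :
    bracket n (polarizedPsum n a 0) (polarizedPsum n 0 b) =
      ((a * b : ℕ) : ℚ) • polarizedPsum n a b := by
  simp only [bracket, polarizedPsum, zVar, wVar, Finset.smul_sum]
  refine Finset.sum_congr rfl fun j _ => ?_
  simp [pderiv_X, Pi.single_apply, Derivation.leibniz_pow, Algebra.smul_def]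
  rcases a with _ | a
  · simp
  rcases b with _ | b
  · simp
  simp only [Nat.add_sub_cancel]
  ring

section PoissonSubalgebra

variable {n : ℕ} {A : Subalgebra ℚ (MvPolynomial (Fin n ⊕ Fin n) ℚ)}

theorem polarizedPsum_mem (he : ∀ k : ℕ, 1 ≤ k → k ≤ n → esymmZ n k ∈ A ∧ esymmW n k ∈ A)
    (hB : ∀ f ∈ A, ∀ g ∈ A, bracket n f g ∈ A) (a b : ℕ) : polarizedPsum n a b ∈ A := by
  have hz (a : ℕ) : polarizedPsum n a 0 ∈ A := by
    simpa [polarizedPsum, psum, zVar] using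
      map_mem_of_isSymmetric (rename Sum.inl) A (fun k h₁ h₂ => (he k h₁ h₂).1)
        (psum_isSymmetric (Fin n) ℚ a)
  have hw (b : ℕ) : polarizedPsum n 0 b ∈ A := by
    simpa [polarizedPsum, psum, wVar] using
      map_mem_of_isSymmetric (rename Sum.inr) A (fun k h₁ h₂ => (he k h₁ h₂).2)
        (psum_isSymmetric (Fin n) ℚ b)
  rcases eq_or_ne a 0 with rfl | ha
  · exact hw b
  rcases eq_or_ne b 0 with rfl | hb
  · exact hz a
  have hab : ((a * b : ℕ) : ℚ) ≠ 0 := by exact_mod_cast mul_ne_zero ha hb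
  have h := hB _ (hz a) _ (hw b)
  rw [bracket_polarizedPsum] at h
  simpa only [inv_smul_smul₀ hab] using A.smul_mem h ((a * b : ℕ) : ℚ)⁻¹

/-- The symmetrization of any polynomial is a polynomial in the polarized power sums. -/
theorem sum_rename_mem (hA : ∀ a b, polarizedPsum n a b ∈ A)
    (f : MvPolynomial (Fin n ⊕ Fin n) ℚ) :
    ∑ π : Equiv.Perm (Fin n), rename (Sum.map π π) f ∈ A := by
  let M : Submonoid (Fin n → MvPolynomial (Fin n ⊕ Fin n) ℚ) :=
    { carrier := Set.range fun c : ℕ × ℕ => fun i => zVar n i ^ c.1 * wVar n i ^ c.2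
      one_mem' := ⟨(0, 0), by ext; simp⟩
      mul_mem' := by
        rintro _ _ ⟨c, rfl⟩ ⟨d, rfl⟩
        refine ⟨c + d, ?_⟩
        funext i
        simp only [Pi.mul_apply, Prod.fst_add, Prod.snd_add]
        ring }
  induction f using MvPolynomial.induction_on' with
  | add p q hp hq => simpa [Finset.sum_add_distrib] using add_mem hp hq
  | monomial d c =>
    have hd (π : Equiv.Perm (Fin n)) : rename (Sum.map π π) (monomial d c) =
        c • ∏ j, zVar n (π j) ^ d (Sum.inl j) * wVar n (π j) ^ d (Sum.inr j) := by
      rw [monomial_eq, Finsupp.prod_fintype _ _ fun _ => pow_zero _]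
      simp [zVar, wVar, Finset.prod_mul_distrib, smul_eq_C_mul]
    simp only [hd, ← Finset.smul_sum]
    refine A.smul_mem (sum_perm_mem A M ?_
      (fun j i => zVar n i ^ d (Sum.inl j) * wVar n i ^ d (Sum.inr j)) fun j => ⟨(_, _), rfl⟩) c
    rintro _ ⟨c, rfl⟩
    exact hA c.1 c.2

theorem bisymmetricFunctions_le (hA : ∀ a b, polarizedPsum n a b ∈ A) :
    bisymmetricFunctions n ≤ A := by
  intro f hf
  rw [mem_bisymmetricFunctions] at hf
  have h := sum_rename_mem hA f
  simp only [hf, Finset.sum_const, Finset.card_univ, Fintype.card_perm, Fintype.card_fin,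
    ← Nat.cast_smul_eq_nsmul ℚ] at h
  have hn : (n.factorial : ℚ) ≠ 0 := by exact_mod_cast n.factorial_ne_zero
  simpa only [inv_smul_smul₀ hn] using A.smul_mem h (n.factorial : ℚ)⁻¹

end PoissonSubalgebra

/-- The ring of bisymmetric functions is the smallest `ℚ`-subalgebra of
`ℚ[z_1,…,z_n,w_1,…,w_n]` containing the elementary symmetric polynomials
`e_1(z),…,e_n(z)` and `e_1(w),…,e_n(w)` and closed under the bracket `B`. -/
theorem bisymmetric_eq_poissonClosure_of_esymm (n : ℕ) (hn : 1 ≤ n) :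
    bisymmetricFunctions n =
      sInf {A : Subalgebra ℚ (MvPolynomial (Fin n ⊕ Fin n) ℚ) |
        (∀ k : ℕ, 1 ≤ k → k ≤ n → esymmZ n k ∈ A ∧ esymmW n k ∈ A) ∧
        (∀ f ∈ A, ∀ g ∈ A, bracket n f g ∈ A)} := by
  apply le_antisymm
  · exact le_sInf fun A hA => bisymmetricFunctions_le (polarizedPsum_mem hA.1 hA.2)
  · exact sInf_le ⟨fun k _ _ =>
      ⟨esymmZ_mem_bisymmetricFunctions n k, esymmW_mem_bisymmetricFunctions n k⟩,
      fun _ hf _ hg => bracket_mem_bisymmetricFunctions hf hg⟩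
end

section
/- In the polynomial ring ℚ[z_1,…,z_n,w_1,…,w_n], for every index j with 1 ≤ j ≤ n one has the identity Σ_{r=0}^{n−1} (−1)^r z_j^{n−1−r} σ_{(r,1)} = w_j · ∏_{k≠j} (z_j − z_k), where σ_{(r,1)} = Σ_{k=1}^n w_k · e_r({z_l : l ≠ k}) and e_r denotes the r-th elementary symmetric polynomial in the indicated n−1 variables. -/
open MvPolynomial

/-- The elementary bisymmetric function
`σ_{(r,1)} = Σ_{k=1}^n w_k · e_r({z_l : l ≠ k})`, where `e_r` is the `r`-th
elementary symmetric polynomial in the indicated `n−1` variables. -/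
noncomputable def sigmaR1 (n : ℕ) (r : ℕ) : MvPolynomial (Fin n ⊕ Fin n) ℚ :=
  ∑ k : Fin n, wVar n k *
    ∑ A ∈ (Finset.univ.erase k).powersetCard r, ∏ a ∈ A, zVar n a

/-- Expansion of `∏ (x - f i)` in elementary symmetric sums of the `f i`. -/
theorem Finset.prod_const_sub_eq_sum_powersetCard {ι R : Type*} [DecidableEq ι] [CommRing R]
    (s : Finset ι) (x : R) (f : ι → R) :
    ∏ i ∈ s, (x - f i) =
      ∑ r ∈ Finset.range (s.card + 1),
        (-1) ^ r * x ^ (s.card - r) * ∑ A ∈ s.powersetCard r, ∏ a ∈ A, f a := by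
  simp_rw [sub_eq_neg_add, Finset.prod_add, Finset.sum_powerset, Finset.mul_sum]
  refine Finset.sum_congr rfl fun r _ => Finset.sum_congr rfl fun A hA => ?_
  obtain ⟨hAs, rfl⟩ := Finset.mem_powersetCard.mp hA
  rw [Finset.prod_neg, Finset.prod_const, Finset.card_sdiff_of_subset hAs]
  ring

/-- `Σ_{r=0}^{n−1} (−1)^r z_j^{n−1−r} σ_{(r,1)} = w_j · ∏_{k≠j} (z_j − z_k)`. -/
theorem alternating_sum_sigmaR1 (n : ℕ) (hn : 1 ≤ n) (j : Fin n) :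
    ∑ r ∈ Finset.range n, (-1 : MvPolynomial (Fin n ⊕ Fin n) ℚ) ^ r *
        zVar n j ^ (n - 1 - r) * sigmaR1 n r =
      wVar n j * ∏ k ∈ Finset.univ.erase j, (zVar n j - zVar n k) := by
  have expand (k : Fin n) :
      ∏ l ∈ Finset.univ.erase k, (zVar n j - zVar n l) =
        ∑ r ∈ Finset.range n, (-1) ^ r * zVar n j ^ (n - 1 - r) *
          ∑ A ∈ (Finset.univ.erase k).powersetCard r, ∏ a ∈ A, zVar n a := by
    rw [Finset.prod_const_sub_eq_sum_powersetCard, Finset.card_erase_of_mem (Finset.mem_univ k),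
      Finset.card_fin, Nat.sub_add_cancel hn]
  calc
    _ = ∑ k, wVar n k * ∏ l ∈ Finset.univ.erase k, (zVar n j - zVar n l) := by
      simp_rw [expand, sigmaR1, Finset.mul_sum (s := Finset.univ),
        Finset.mul_sum (s := Finset.range n)]
      rw [Finset.sum_comm]
      exact Finset.sum_congr rfl fun k _ => Finset.sum_congr rfl fun r _ => mul_left_comm _ _ _
    _ = _ := by
      refine Finset.sum_eq_single_of_mem j (Finset.mem_univ j) fun k _ hkj => ?_
      rw [Finset.prod_eq_zero (Finset.mem_erase.mpr ⟨hkj.symm, Finset.mem_univ j⟩) (sub_self _),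
        mul_zero]
end

section
/- Let φ : ℚ[A,B,C,D,E] → ℚ[z_1,z_2,w_1,w_2] be the ℚ-algebra homomorphism with φ(A) = z_1+z_2, φ(B) = w_1+w_2, φ(C) = z_1 z_2, φ(D) = w_1 w_2 and φ(E) = z_1 w_2 + z_2 w_1. Then the kernel of φ is the principal ideal generated by the single polynomial (A² − 4C)(B² − 4D) − (AB − 2E)². -/
open MvPolynomial

/-- The `ℚ`-algebra homomorphism `φ : ℚ[A,B,C,D,E] → ℚ[z_1,z_2,w_1,w_2]` with
`φ(A) = z_1+z_2`, `φ(B) = w_1+w_2`, `φ(C) = z_1 z_2`, `φ(D) = w_1 w_2` and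
`φ(E) = z_1 w_2 + z_2 w_1`. -/
noncomputable def phi : MvPolynomial (Fin 5) ℚ →ₐ[ℚ] MvPolynomial (Fin 2 ⊕ Fin 2) ℚ :=
  aeval ![X (Sum.inl 0) + X (Sum.inl 1),
          X (Sum.inr 0) + X (Sum.inr 1),
          X (Sum.inl 0) * X (Sum.inl 1),
          X (Sum.inr 0) * X (Sum.inr 1),
          X (Sum.inl 0) * X (Sum.inr 1) + X (Sum.inl 1) * X (Sum.inr 0)]

/-- A rational polynomial vanishing at all complex points is zero. -/
theorem eq_zero_of_forall_aeval_complex {σ : Type*} (r : MvPolynomial σ ℚ)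
    (h : ∀ v : σ → ℂ, aeval v r = 0) : r = 0 := by
  apply map_injective (algebraMap ℚ ℂ) (algebraMap ℚ ℂ).injective
  apply MvPolynomial.funext
  intro v
  rw [map_zero, map_zero, eval_map, ← aeval_def, h v]

/-- Over `ℂ`, two numbers with prescribed sum and product exist. -/
theorem exists_add_eq_and_mul_eq (a c : ℂ) : ∃ x y : ℂ, x + y = a ∧ x * y = c := by
  obtain ⟨s, hs⟩ := IsAlgClosed.exists_pow_nat_eq (a ^ 2 - 4 * c) two_pos
  exact ⟨(a + s) / 2, (a - s) / 2, by ring, by linear_combination -hs / 4⟩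

/-- The relation `(A² − 4C)(B² − 4D) − (AB − 2E)²`. -/
noncomputable def bisymmetricRelation : MvPolynomial (Fin 5) ℚ :=
  (X 0 ^ 2 - 4 * X 2) * (X 1 ^ 2 - 4 * X 3) - (X 0 * X 1 - 2 * X 4) ^ 2

/-- Evaluating `phi p` at a complex point. -/
theorem aeval_phi (z₁ z₂ w₁ w₂ : ℂ) (p : MvPolynomial (Fin 5) ℚ) :
    aeval (Sum.elim ![z₁, z₂] ![w₁, w₂]) (phi p) =
      aeval ![z₁ + z₂, w₁ + w₂, z₁ * z₂, w₁ * w₂, z₁ * w₂ + z₂ * w₁] p := by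
  rw [phi, ← AlgHom.comp_apply]
  congr 1
  ext i
  fin_cases i <;> simp

theorem phi_bisymmetricRelation : phi bisymmetricRelation = 0 := by
  simp only [bisymmetricRelation, phi, map_sub, map_mul, map_pow, map_ofNat, aeval_X,
    Matrix.cons_val]
  ring

/-- Modulo the relation, every polynomial is of degree at most one in `E`. -/
theorem exists_linear_remainder (p : MvPolynomial (Fin 5) ℚ) :
    ∃ r s : MvPolynomial (Fin 4) ℚ,
      bisymmetricRelation ∣ p - (rename Fin.castSucc r + rename Fin.castSucc s * X 4) := by
  induction p using MvPolynomial.induction_on with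
  | C a => exact ⟨C a, 0, by simp⟩
  | add p q hp hq =>
    obtain ⟨r, s, h⟩ := hp
    obtain ⟨r', s', h'⟩ := hq
    refine ⟨r + r', s + s', ?_⟩
    convert dvd_add h h' using 1
    simp only [map_add]
    ring
  | mul_X p i hp =>
    obtain ⟨r, s, t, h⟩ := hp
    induction i using Fin.lastCases with
    | cast i =>
      refine ⟨r * X i, s * X i, t * X i.castSucc, ?_⟩
      simp only [map_mul, rename_X]
      linear_combination X i.castSucc * h
    | last =>
      refine ⟨s * (4 * X 2 * X 3 - X 0 ^ 2 * X 3 - X 1 ^ 2 * X 2), r + s * X 0 * X 1,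
        t * X 4 - C (1 / 4) * rename Fin.castSucc s, ?_⟩
      have hC : (4 : MvPolynomial (Fin 5) ℚ) * C (1 / 4) = 1 := by
        rw [← map_ofNat (C : ℚ →+* MvPolynomial (Fin 5) ℚ) 4, ← C_mul]
        norm_num
      have e0 : Fin.castSucc (0 : Fin 4) = 0 := rfl
      have e1 : Fin.castSucc (1 : Fin 4) = 1 := rfl
      have e2 : Fin.castSucc (2 : Fin 4) = 2 := rfl
      have e3 : Fin.castSucc (3 : Fin 4) = 3 := rfl
      have e4 : Fin.last 4 = 4 := rfl
      simp only [map_mul, map_add, map_sub, map_pow, map_ofNat, rename_X, e0, e1, e2, e3, e4]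
      unfold bisymmetricRelation at h ⊢
      linear_combination X 4 * h + rename Fin.castSucc s *
        (X 4 ^ 2 - X 0 * X 1 * X 4 + X 0 ^ 2 * X 3 + X 1 ^ 2 * X 2 - 4 * X 2 * X 3) * -hC

/-- A polynomial of degree at most one in `E` that is killed by `phi` is zero. -/
theorem eq_zero_of_phi_linear_eq_zero (r s : MvPolynomial (Fin 4) ℚ)
    (h : phi (rename Fin.castSucc r + rename Fin.castSucc s * X 4) = 0) : r = 0 ∧ s = 0 := by
  have key (z₁ z₂ w₁ w₂ : ℂ) :
      aeval ![z₁ + z₂, w₁ + w₂, z₁ * z₂, w₁ * w₂] r +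
        aeval ![z₁ + z₂, w₁ + w₂, z₁ * z₂, w₁ * w₂] s * (z₁ * w₂ + z₂ * w₁) = 0 := by
    have hz := aeval_phi z₁ z₂ w₁ w₂ (rename Fin.castSucc r + rename Fin.castSucc s * X 4)
    have hv : ![z₁ + z₂, w₁ + w₂, z₁ * z₂, w₁ * w₂, z₁ * w₂ + z₂ * w₁] ∘ Fin.castSucc =
        ![z₁ + z₂, w₁ + w₂, z₁ * z₂, w₁ * w₂] := by
      ext i
      fin_cases i <;> rfl
    rw [h, map_zero, map_add, map_mul, aeval_rename, aeval_rename, hv, aeval_X] at hz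
    exact hz.symm
  have hdisc : s ^ 2 * ((X 0 ^ 2 - 4 * X 2) * (X 1 ^ 2 - 4 * X 3)) = 0 := by
    apply eq_zero_of_forall_aeval_complex
    intro v
    obtain ⟨z₁, z₂, ha, hc⟩ := exists_add_eq_and_mul_eq (v 0) (v 2)
    obtain ⟨w₁, w₂, hb, hd⟩ := exists_add_eq_and_mul_eq (v 1) (v 3)
    have hv : v = ![z₁ + z₂, w₁ + w₂, z₁ * z₂, w₁ * w₂] := by
      ext i
      fin_cases i <;> simp [*]
    have h₁ := key z₁ z₂ w₁ w₂
    have h₂ := key z₂ z₁ w₁ w₂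
    rw [add_comm z₂ z₁, mul_comm z₂ z₁, ← hv] at h₂
    rw [← hv] at h₁
    have h₃ : aeval v s * ((z₁ - z₂) * (w₁ - w₂)) = 0 := by linear_combination h₂ - h₁
    simp only [map_mul, map_sub, map_pow, map_ofNat, aeval_X, ← ha, ← hb, ← hc, ← hd]
    linear_combination aeval v s * ((z₁ - z₂) * (w₁ - w₂)) * h₃
  have ne_zero {p : MvPolynomial (Fin 4) ℚ} (v : Fin 4 → ℚ) (hp : eval v p ≠ 0) : p ≠ 0 := by
    rintro rfl
    simp at hp
  have hA : (X 0 ^ 2 - 4 * X 2 : MvPolynomial (Fin 4) ℚ) ≠ 0 := ne_zero ![1, 0, 0, 0] (by simp)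
  have hB : (X 1 ^ 2 - 4 * X 3 : MvPolynomial (Fin 4) ℚ) ≠ 0 := ne_zero ![0, 1, 0, 0] (by simp)
  have hs : s = 0 := by simpa [hA, hB] using hdisc
  refine ⟨eq_zero_of_forall_aeval_complex r fun v => ?_, hs⟩
  obtain ⟨z₁, z₂, ha, hc⟩ := exists_add_eq_and_mul_eq (v 0) (v 2)
  obtain ⟨w₁, w₂, hb, hd⟩ := exists_add_eq_and_mul_eq (v 1) (v 3)
  have hv : v = ![z₁ + z₂, w₁ + w₂, z₁ * z₂, w₁ * w₂] := by
    ext i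
    fin_cases i <;> simp [*]
  simpa [hs, ← hv] using key z₁ z₂ w₁ w₂

/-- The kernel of `φ` is the principal ideal generated by
`(A² − 4C)(B² − 4D) − (AB − 2E)²`. -/
theorem ker_phi_eq_span_relation :
    RingHom.ker (phi : MvPolynomial (Fin 5) ℚ →+* MvPolynomial (Fin 2 ⊕ Fin 2) ℚ) =
      Ideal.span
        {((X 0 : MvPolynomial (Fin 5) ℚ) ^ 2 - 4 * X 2) * ((X 1) ^ 2 - 4 * X 3) -
          (X 0 * X 1 - 2 * X 4) ^ 2} := by
  change _ = Ideal.span {bisymmetricRelation}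
  ext p
  rw [RingHom.mem_ker, Ideal.mem_span_singleton]
  change phi p = 0 ↔ _
  constructor
  · intro hp
    obtain ⟨r, s, t, h⟩ := exists_linear_remainder p
    have hphi := congrArg phi h
    rw [map_sub, hp, map_mul, phi_bisymmetricRelation, zero_mul, zero_sub, neg_eq_zero] at hphi
    obtain ⟨rfl, rfl⟩ := eq_zero_of_phi_linear_eq_zero r s hphi
    exact ⟨t, by simpa using h⟩
  · rintro ⟨t, rfl⟩
    rw [map_mul, phi_bisymmetricRelation, zero_mul]
end

section
/- Let z = x + iy be a nonzero complex number, write r² = x² + y², and set X = x + x/r², Y = y − y/r², and b = (r² + r^{-2})/2. Then Y² = b² − 1 − (b − 1)·(X² + Y²)/2. -/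
/-- For a nonzero complex number `z = x + iy`, with `r² = x² + y²`,
`X = x + x/r²`, `Y = y − y/r²` and `b = (r² + r⁻²)/2`, one has
`Y² = b² − 1 − (b − 1)(X² + Y²)/2`. -/
theorem su2_real_relation (x y : ℝ) (h : x ^ 2 + y ^ 2 ≠ 0) :
    (y - y / (x ^ 2 + y ^ 2)) ^ 2 =
      ((x ^ 2 + y ^ 2 + (x ^ 2 + y ^ 2)⁻¹) / 2) ^ 2 - 1 -
        ((x ^ 2 + y ^ 2 + (x ^ 2 + y ^ 2)⁻¹) / 2 - 1) *
          ((x + x / (x ^ 2 + y ^ 2)) ^ 2 + (y - y / (x ^ 2 + y ^ 2)) ^ 2) / 2 := by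
  field_simp
  ring
end

section
/- Let z = x + iy be a nonzero complex number, write r² = x² + y², and set X = x + x/r², Y = y − y/r², and b = (r² + r^{-2})/2. Then b = (X² + Y²)/4 + √(1 + (Y² − X²)/2 + (X² + Y²)²/16), where the expression under the square root is nonnegative. -/
/-- For a nonzero complex number `z = x + iy`, with `r² = x² + y²`,
`X = x + x/r²`, `Y = y − y/r²` and `b = (r² + r⁻²)/2`, one has
`b = (X² + Y²)/4 + √(1 + (Y² − X²)/2 + (X² + Y²)²/16)`, the expression under
the square root being nonnegative. -/
theorem su2_b_formula (x y : ℝ) (h : x ^ 2 + y ^ 2 ≠ 0) :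
    0 ≤ 1 + ((y - y / (x ^ 2 + y ^ 2)) ^ 2 - (x + x / (x ^ 2 + y ^ 2)) ^ 2) / 2 +
        ((x + x / (x ^ 2 + y ^ 2)) ^ 2 + (y - y / (x ^ 2 + y ^ 2)) ^ 2) ^ 2 / 16 ∧
      (x ^ 2 + y ^ 2 + (x ^ 2 + y ^ 2)⁻¹) / 2 =
        ((x + x / (x ^ 2 + y ^ 2)) ^ 2 + (y - y / (x ^ 2 + y ^ 2)) ^ 2) / 4 +
          Real.sqrt (1 +
            ((y - y / (x ^ 2 + y ^ 2)) ^ 2 - (x + x / (x ^ 2 + y ^ 2)) ^ 2) / 2 +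
            ((x + x / (x ^ 2 + y ^ 2)) ^ 2 + (y - y / (x ^ 2 + y ^ 2)) ^ 2) ^ 2 / 16) := by
  have hradicand : 1 +
      ((y - y / (x ^ 2 + y ^ 2)) ^ 2 - (x + x / (x ^ 2 + y ^ 2)) ^ 2) / 2 +
      ((x + x / (x ^ 2 + y ^ 2)) ^ 2 + (y - y / (x ^ 2 + y ^ 2)) ^ 2) ^ 2 / 16 =
      (((x ^ 2 - y ^ 2 - 1) ^ 2 + (2 * x * y) ^ 2) / (4 * (x ^ 2 + y ^ 2))) ^ 2 := by
    field_simp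
    ring
  rw [hradicand]
  refine ⟨sq_nonneg _, ?_⟩
  rw [Real.sqrt_sq (by positivity)]
  field_simp
  ring
end

section
/- The power series Σ_{j=0}^∞ w^j/(2j)! converges for every real w, and the function Ch : ℝ → ℝ it defines satisfies Ch(t²) = cosh(t) for all real t and is strictly increasing on the open interval (−π², ∞). -/
/-- The entire function `Ch(w) = Σ_{j=0}^∞ w^j/(2j)!`, so that
`Ch(w²) = cosh(w)` and `Ch(−w²) = cos(w)`. -/
noncomputable def Ch (w : ℝ) : ℝ :=
  ∑' j : ℕ, w ^ j / (Nat.factorial (2 * j) : ℝ)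

theorem hasSum_Ch_sq (t : ℝ) :
    HasSum (fun j : ℕ => (t ^ 2) ^ j / (Nat.factorial (2 * j) : ℝ)) (Real.cosh t) := by
  simpa only [pow_mul] using Real.hasSum_cosh t

theorem hasSum_Ch_neg_sq (t : ℝ) :
    HasSum (fun j : ℕ => (-t ^ 2) ^ j / (Nat.factorial (2 * j) : ℝ)) (Real.cos t) := by
  simpa only [neg_pow (t ^ 2), pow_mul] using Real.hasSum_cos t

theorem Ch_sq (t : ℝ) : Ch (t ^ 2) = Real.cosh t :=
  (hasSum_Ch_sq t).tsum_eq

theorem Ch_neg_sq (t : ℝ) : Ch (-t ^ 2) = Real.cos t :=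
  (hasSum_Ch_neg_sq t).tsum_eq

theorem Ch_of_nonneg {w : ℝ} (hw : 0 ≤ w) : Ch w = Real.cosh √w := by
  rw [← Ch_sq, Real.sq_sqrt hw]

theorem Ch_of_nonpos {w : ℝ} (hw : w ≤ 0) : Ch w = Real.cos √(-w) := by
  rw [← Ch_neg_sq, Real.sq_sqrt (neg_nonneg.2 hw), neg_neg]

theorem summable_Ch (w : ℝ) : Summable fun j : ℕ => w ^ j / (Nat.factorial (2 * j) : ℝ) := by
  rcases le_total 0 w with hw | hw
  · simpa only [Real.sq_sqrt hw] using (hasSum_Ch_sq √w).summable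
  · simpa only [Real.sq_sqrt (neg_nonneg.2 hw), neg_neg] using (hasSum_Ch_neg_sq √(-w)).summable

theorem strictMonoOn_Ch_Ici : StrictMonoOn Ch (Set.Ici 0) := by
  intro a ha b hb hab
  rw [Ch_of_nonneg ha, Ch_of_nonneg hb]
  exact Real.cosh_strictMonoOn (Real.sqrt_nonneg a) (Real.sqrt_nonneg b)
    (Real.sqrt_lt_sqrt ha hab)

theorem strictMonoOn_Ch_Icc : StrictMonoOn Ch (Set.Icc (-Real.pi ^ 2) 0) := by
  have mem {w : ℝ} (hw : -Real.pi ^ 2 ≤ w) : √(-w) ∈ Set.Icc 0 Real.pi :=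
    ⟨Real.sqrt_nonneg _, Real.sqrt_le_iff.2 ⟨Real.pi_pos.le, by linarith⟩⟩
  intro a ha b hb hab
  rw [Ch_of_nonpos ha.2, Ch_of_nonpos hb.2]
  exact Real.strictAntiOn_cos (mem hb.1) (mem ha.1)
    (Real.sqrt_lt_sqrt (neg_nonneg.2 hb.2) (neg_lt_neg hab))

theorem strictMonoOn_Ch_Ici_neg_pi_sq : StrictMonoOn Ch (Set.Ici (-Real.pi ^ 2)) := by
  have hpi : -Real.pi ^ 2 ≤ 0 := neg_nonpos.2 (sq_nonneg _)
  rw [← Set.Icc_union_Ici_eq_Ici hpi]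
  exact strictMonoOn_Ch_Icc.union strictMonoOn_Ch_Ici (isGreatest_Icc hpi) isLeast_Ici

/-- The series `Σ w^j/(2j)!` converges for every real `w`, the function `Ch`
it defines satisfies `Ch(t²) = cosh(t)` for all real `t`, and `Ch` is strictly
increasing on `(−π², ∞)`. -/
theorem Ch_summable_cosh_strictMono :
    (∀ w : ℝ, Summable fun j : ℕ => w ^ j / (Nat.factorial (2 * j) : ℝ)) ∧
    (∀ t : ℝ, Ch (t ^ 2) = Real.cosh t) ∧
    StrictMonoOn Ch (Set.Ioi (-Real.pi ^ 2)) := by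
  exact ⟨summable_Ch, Ch_sq, strictMonoOn_Ch_Ici_neg_pi_sq.mono Set.Ioi_subset_Ici_self⟩
end
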